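/- Let γ ≥ 0 and let ρ be a probability distribution on ℝ belonging to the class S_♯. Then ρ belongs to the class S(γ) if and only if ρ belongs to the class L(γ). -/

import Mathlib

open MeasureTheory Filter Set

/-- The tail `ξ((x,∞))` of a measure on `ℝ`, as a real number. -/
noncomputable def tail (ξ : MeasureTheory.Measure ℝ) (x : ℝ) : ℝ :=
  (ξ (Set.Ioi x)).toReal

/-- The `n`-fold convolution power of a measure, with `ξ^{0*} = δ₀`. -/
noncomputable def convPow (ρ : MeasureTheory.Measure ℝ) : ℕ → MeasureTheory.Measure ℝ
  | 0 => MeasureTheory.Measure.dirac 0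
  | n + 1 => (convPow ρ n).conv ρ

/-- `ξ ≍ ζ` for tails: `0 < liminf tail ξ/tail ζ ≤ limsup tail ξ/tail ζ < ∞`
(taken in `ℝ≥0∞`). -/
def TailAsymp (ξ ζ : MeasureTheory.Measure ℝ) : Prop :=
  0 < Filter.atTop.liminf (fun x : ℝ => ξ (Set.Ioi x) / ζ (Set.Ioi x)) ∧
    Filter.atTop.limsup (fun x : ℝ => ξ (Set.Ioi x) / ζ (Set.Ioi x)) < ⊤

/-- The class `OS` of O-subexponential distributions. -/
def MemOS (ρ : MeasureTheory.Measure ℝ) : Prop :=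
  (∀ x : ℝ, 0 < x → 0 < ρ (Set.Ioi x)) ∧ TailAsymp (convPow ρ 2) ρ

/-- The class `L(γ)`: `tail ρ(x+a) ~ e^{-γ a} tail ρ(x)` for every `a`. -/
def MemL (γ : ℝ) (ρ : MeasureTheory.Measure ℝ) : Prop :=
  (∀ x : ℝ, 0 < x → 0 < ρ (Set.Ioi x)) ∧
    ∀ a : ℝ, Filter.Tendsto
      (fun x : ℝ => tail ρ (x + a) / (Real.exp (-γ * a) * tail ρ x))
      Filter.atTop (nhds 1)

/-- The class `S(γ)`. -/
def MemS (γ : ℝ) (ρ : MeasureTheory.Measure ℝ) : Prop :=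
  MemL γ ρ ∧ MeasureTheory.Integrable (fun x : ℝ => Real.exp (γ * x)) ρ ∧
    Filter.Tendsto
      (fun x : ℝ => tail (ρ.conv ρ) x /
        (2 * (∫ y : ℝ, Real.exp (γ * y) ∂ρ) * tail ρ x))
      Filter.atTop (nhds 1)

/-- The class `S_♯`. -/
def MemSsharp (ρ : MeasureTheory.Measure ℝ) : Prop :=
  MemOS ρ ∧
    Filter.atTop.limsup (fun A : ℝ => Filter.atTop.limsup (fun x : ℝ =>
      (tail ρ (x - A) * tail ρ A + ∫ u in Set.Ioc A (x - A), tail ρ (x - u) ∂ρ)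
        / tail ρ x)) = 0

lemma aux_meas (x : ℝ) : MeasurableSet {p : ℝ × ℝ | x < p.1 + p.2} :=
  measurableSet_lt measurable_const (measurable_fst.add measurable_snd)

lemma aux_anti (ρ : Measure ℝ) [IsProbabilityMeasure ρ] : Antitone (tail ρ) := by
  intro a b hab
  exact ENNReal.toReal_mono (measure_ne_top _ _) (measure_mono (Ioi_subset_Ioi hab))

lemma aux_sec (ρ : Measure ℝ) [IsProbabilityMeasure ρ] (B : Set ℝ) (hB : MeasurableSet B) (x : ℝ) :
    (ρ.prod ρ).real ({p : ℝ × ℝ | p.1 ∈ B} ∩ {p | x < p.1 + p.2})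
      = ∫ u in B, tail ρ (x - u) ∂ρ := by
  have hm : MeasurableSet ({p : ℝ × ℝ | p.1 ∈ B} ∩ {p | x < p.1 + p.2}) :=
    (measurable_fst hB).inter (aux_meas x)
  have hmono : Monotone (fun u => tail ρ (x - u)) := fun a b hab =>
    aux_anti ρ (by linarith)
  rw [integral_eq_lintegral_of_nonneg_ae (f := fun u => tail ρ (x - u))
    (ae_of_all _ fun u => ENNReal.toReal_nonneg)
    hmono.measurable.aestronglyMeasurable, Measure.real, Measure.prod_apply hm]
  congr 1
  rw [← lintegral_indicator hB]
  refine lintegral_congr fun u => ?_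
  by_cases hu : u ∈ B
  · rw [indicator_of_mem hu]
    simp only [tail]
    rw [ENNReal.ofReal_toReal (measure_ne_top _ _)]
    congr 1
    ext v
    simp [hu, sub_lt_iff_lt_add']
  · rw [indicator_of_notMem hu]
    have : (Prod.mk u ⁻¹' ({p : ℝ × ℝ | p.1 ∈ B} ∩ {p | x < p.1 + p.2})) = ∅ := by
      ext v
      simp [hu]
    rw [this, measure_empty]

lemma aux_decomp (ρ : Measure ℝ) [IsProbabilityMeasure ρ] (A x : ℝ) (hx : 2 * A ≤ x) :
    tail (ρ.conv ρ) x = 2 * (∫ u in Iic A, tail ρ (x - u) ∂ρ) +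
      (tail ρ (x - A) * tail ρ A + ∫ u in Ioc A (x - A), tail ρ (x - u) ∂ρ) := by
  have h0 : tail (ρ.conv ρ) x = (ρ.prod ρ).real {p : ℝ × ℝ | x < p.1 + p.2} := by
    rw [tail, Measure.conv, Measure.map_apply (by fun_prop) measurableSet_Ioi]
    rfl
  have h1 := aux_sec ρ (Iic A) measurableSet_Iic x
  have h2 := aux_sec ρ (Ioc A (x - A)) measurableSet_Ioc x
  have h3 : (ρ.prod ρ).real (Ioi (x - A) ×ˢ Ioi A) = tail ρ (x - A) * tail ρ A := by
    rw [measureReal_prod_prod]; rfl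
  have h4 : (ρ.prod ρ).real ({p : ℝ × ℝ | p.2 ∈ Iic A} ∩ {p | x < p.1 + p.2})
      = ∫ u in Iic A, tail ρ (x - u) ∂ρ := by
    rw [← h1, Measure.real, Measure.real]
    congr 1
    have hm : MeasurableSet ({p : ℝ × ℝ | p.1 ∈ Iic A} ∩ {p | x < p.1 + p.2}) :=
      (measurable_fst measurableSet_Iic).inter (aux_meas x)
    rw [← (Measure.measurePreserving_swap (μ := ρ) (ν := ρ)).measure_preimage hm.nullMeasurableSet]
    congr 1
    ext ⟨a, b⟩
    simp [add_comm]
  have m2 : MeasurableSet ({p : ℝ × ℝ | p.1 ∈ Ioc A (x - A)} ∩ {p | x < p.1 + p.2}) :=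
    (measurable_fst measurableSet_Ioc).inter (aux_meas x)
  have m3 : MeasurableSet (Ioi (x - A) ×ˢ Ioi A) := measurableSet_Ioi.prod measurableSet_Ioi
  have m4 : MeasurableSet ({p : ℝ × ℝ | p.2 ∈ Iic A} ∩ {p | x < p.1 + p.2}) :=
    (measurable_snd measurableSet_Iic).inter (aux_meas x)
  have hU : {p : ℝ × ℝ | x < p.1 + p.2} =
      ((({p : ℝ × ℝ | p.1 ∈ Iic A} ∩ {p | x < p.1 + p.2}) ∪
      ({p : ℝ × ℝ | p.1 ∈ Ioc A (x - A)} ∩ {p | x < p.1 + p.2})) ∪ (Ioi (x - A) ×ˢ Ioi A)) ∪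
      ({p : ℝ × ℝ | p.2 ∈ Iic A} ∩ {p | x < p.1 + p.2}) := by
    ext ⟨a, b⟩
    simp only [mem_ofPred_eq, mem_union, mem_inter_iff, mem_Iic, mem_Ioc, mem_prod, mem_Ioi]
    constructor
    · intro h
      by_cases ha : a ≤ A
      · tauto
      by_cases ha2 : a ≤ x - A
      · push Not at ha; tauto
      by_cases hb : b ≤ A
      · tauto
      push Not at ha2 hb; tauto
    · rintro (((h | h) | h) | h)
      · exact h.2
      · exact h.2
      · linarith [h.1, h.2]
      · exact h.2
  rw [h0, hU, measureReal_union _ m4, measureReal_union _ m3, measureReal_union _ m2, h1, h2, h3, h4]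
  · ring
  · rw [disjoint_left]
    rintro ⟨a, b⟩
    simp only [mem_ofPred_eq, mem_inter_iff, mem_Iic, mem_Ioc]
    intro h h'
    linarith [h.1, h'.1.1]
  · rw [disjoint_left]
    rintro ⟨a, b⟩
    simp only [mem_ofPred_eq, mem_union, mem_inter_iff, mem_Iic, mem_Ioc, mem_prod, mem_Ioi]
    rintro (h | h) h'
    · linarith [h.1, h'.1]
    · linarith [h.1.2, h'.1]
  · rw [disjoint_left]
    rintro ⟨a, b⟩
    simp only [mem_ofPred_eq, mem_union, mem_inter_iff, mem_Iic, mem_Ioc, mem_prod, mem_Ioi]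
    rintro ((h | h) | h) h'
    · linarith [h.1, h'.1, h'.2]
    · linarith [h.1.2, h'.1, h'.2]
    · linarith [h.2, h'.1]

lemma aux_pos (ρ : Measure ℝ) [IsProbabilityMeasure ρ] (h : ∀ x : ℝ, 0 < x → 0 < ρ (Ioi x))
    (x : ℝ) : 0 < tail ρ x := by
  refine ENNReal.toReal_pos (ne_of_gt ?_) (measure_ne_top _ _)
  exact (h (max x 1) (by positivity)).trans_le (measure_mono (Ioi_subset_Ioi (le_max_left _ _)))

lemma aux_OS (ρ : Measure ℝ) [IsProbabilityMeasure ρ] (h : MemOS ρ) :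
    ∃ C : ℝ, 0 ≤ C ∧ ∀ᶠ x in atTop, tail (ρ.conv ρ) x / tail ρ x ≤ C := by
  obtain ⟨C, hC1, hC2⟩ := exists_between h.2.2
  refine ⟨C.toReal, ENNReal.toReal_nonneg, ?_⟩
  filter_upwards [eventually_lt_of_limsup_lt hC1] with x hx
  have : convPow ρ 2 = ρ.conv ρ := by
    simp [convPow]
  rw [this] at hx
  rw [tail, tail, ← ENNReal.toReal_div]
  exact ENNReal.toReal_mono hC2.ne hx.le

lemma aux_sharp (ρ : Measure ℝ) [IsProbabilityMeasure ρ] (h : MemSsharp ρ) (ε : ℝ) (hε : 0 < ε) :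
    ∀ᶠ A in atTop, ∀ᶠ x in atTop,
      (tail ρ (x - A) * tail ρ A + ∫ u in Ioc A (x - A), tail ρ (x - u) ∂ρ) / tail ρ x < ε := by
  obtain ⟨C, hC0, hC⟩ := aux_OS ρ h.1
  have hpos := aux_pos ρ h.1.1
  have hnn : ∀ (B : Set ℝ) (x : ℝ), 0 ≤ ∫ u in B, tail ρ (x - u) ∂ρ := fun B x =>
    integral_nonneg fun u => (hpos _).le
  have hb : ∀ A, ∀ᶠ x in atTop,
      (tail ρ (x - A) * tail ρ A + ∫ u in Ioc A (x - A), tail ρ (x - u) ∂ρ) / tail ρ x ≤ C := by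
    intro A
    filter_upwards [hC, eventually_ge_atTop (2 * A)] with x hx hxA
    refine le_trans ?_ hx
    rw [aux_decomp ρ A x hxA]
    have := hpos x
    refine div_le_div_of_nonneg_right ?_ this.le
    linarith [hnn (Iic A) x]
  have hlt := eventually_lt_of_limsup_lt (b := ε) (h.2.trans_lt hε) ?_
  · filter_upwards [hlt] with A hA
    exact eventually_lt_of_limsup_lt hA ⟨C, by simpa using hb A⟩
  · refine ⟨C, ?_⟩
    simp only [eventually_map]
    refine Eventually.of_forall fun A => ?_
    refine limsup_le_of_le ?_ (hb A)
    refine IsCoboundedUnder.of_frequently_ge (a := 0) (Eventually.frequently ?_)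
    refine Eventually.of_forall fun x => ?_
    exact div_nonneg (add_nonneg (mul_nonneg (hpos _).le (hpos _).le) (hnn _ _)) (hpos _).le

lemma aux_dom (γ : ℝ) (hγ : 0 ≤ γ) (ρ : Measure ℝ) [IsProbabilityMeasure ρ] (h : MemL γ ρ) (A : ℝ) :
    IntegrableOn (fun u => Real.exp (γ * u)) (Iic A) ρ ∧
    Tendsto (fun x => (∫ u in Iic A, tail ρ (x - u) ∂ρ) / tail ρ x) atTop
      (nhds (∫ u in Iic A, Real.exp (γ * u) ∂ρ)) := by
  have hpos := aux_pos ρ h.1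
  have hlim : ∀ u, Tendsto (fun x => tail ρ (x - u) / tail ρ x) atTop
      (nhds (Real.exp (γ * u))) := by
    intro u
    have h1 := (h.2 (-u)).mul_const (Real.exp (γ * u))
    rw [one_mul] at h1
    refine h1.congr fun x => ?_
    have e : -γ * -u = γ * u := by ring
    have := (hpos x).ne'
    have := (Real.exp_pos (γ * u)).ne'
    rw [e, ← sub_eq_add_neg]
    field_simp
  constructor
  · refine Integrable.mono' (integrable_const (Real.exp (γ * A)))
      (by fun_prop) ?_
    refine (ae_restrict_iff' measurableSet_Iic).2 (ae_of_all _ fun u hu => ?_)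
    rw [Real.norm_of_nonneg (Real.exp_pos _).le]
    exact Real.exp_le_exp.2 (mul_le_mul_of_nonneg_left hu hγ)
  · simp_rw [← integral_div]
    refine tendsto_integral_filter_of_dominated_convergence (fun _ => Real.exp (γ * A) + 1)
      ?_ ?_ (integrable_const _) (ae_of_all _ hlim)
    · refine Eventually.of_forall fun x => ?_
      have hmono : Monotone (fun u => tail ρ (x - u)) := fun a b hab =>
        aux_anti ρ (by linarith)
      exact (hmono.measurable.div_const _).aestronglyMeasurable
    · filter_upwards [(hlim A).eventually_le_const (lt_add_one _)] with x hx
      refine (ae_restrict_iff' measurableSet_Iic).2 (ae_of_all _ fun u hu => ?_)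
      rw [Real.norm_of_nonneg (div_nonneg (hpos _).le (hpos _).le)]
      refine le_trans ?_ hx
      have := hpos x
      have hu' : u ≤ A := hu
      gcongr
      exact aux_anti ρ (by linarith)

theorem stmt5 (γ : ℝ) (hγ : 0 ≤ γ) (ρ : MeasureTheory.Measure ℝ)
    [MeasureTheory.IsProbabilityMeasure ρ] (hρ : MemSsharp ρ) :
    MemS γ ρ ↔ MemL γ ρ := by
  refine ⟨fun h => h.1, fun hL => ?_⟩
  obtain ⟨C, hC0, hC⟩ := aux_OS ρ hρ.1
  have hpos := aux_pos ρ hρ.1.1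
  have hnn : ∀ (B : Set ℝ) (x : ℝ), 0 ≤ ∫ u in B, tail ρ (x - u) ∂ρ := fun B x =>
    integral_nonneg fun u => (hpos _).le
  have hbd : ∀ A, ∫ u in Iic A, Real.exp (γ * u) ∂ρ ≤ C := by
    intro A
    refine le_of_tendsto (aux_dom γ hγ ρ hL A).2 ?_
    filter_upwards [hC, eventually_ge_atTop (2 * A)] with x hx hxA
    refine le_trans ?_ hx
    rw [aux_decomp ρ A x hxA]
    have := hpos x
    refine div_le_div_of_nonneg_right ?_ this.le
    nlinarith [hnn (Iic A) x, hnn (Ioc A (x - A)) x, mul_nonneg (hpos (x - A)).le (hpos A).le]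
  have hint : Integrable (fun x : ℝ => Real.exp (γ * x)) ρ := by
    exact (aecover_Iic tendsto_id).integrable_of_integral_bounded_of_nonneg_ae C
      (fun A => (aux_dom γ hγ ρ hL A).1) (ae_of_all _ fun x => (Real.exp_pos _).le)
      (Eventually.of_forall hbd)
  have hM : 0 < ∫ y, Real.exp (γ * y) ∂ρ := integral_exp_pos hint
  have hlimA : Tendsto (fun A => ∫ u in Iic A, Real.exp (γ * u) ∂ρ) atTop
      (nhds (∫ y, Real.exp (γ * y) ∂ρ)) :=
    (aecover_Iic tendsto_id).integral_tendsto_of_countably_generated hint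
  have key : Tendsto (fun x => tail (ρ.conv ρ) x / tail ρ x) atTop
      (nhds (2 * ∫ y, Real.exp (γ * y) ∂ρ)) := by
    rw [Metric.tendsto_nhds]
    intro ε hε
    have e1 := aux_sharp ρ hρ (ε / 4) (by positivity)
    have e2 := Metric.tendsto_nhds.1 hlimA (ε / 8) (by positivity)
    obtain ⟨A, hA1, hA2⟩ := (e1.and e2).exists
    filter_upwards [hA1, Metric.tendsto_nhds.1 (aux_dom γ hγ ρ hL A).2 (ε / 8) (by positivity),
      eventually_ge_atTop (2 * A)] with x h1 h2 h3
    have h0 : 0 ≤ (tail ρ (x - A) * tail ρ A + ∫ u in Ioc A (x - A), tail ρ (x - u) ∂ρ) / tail ρ x :=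
      div_nonneg (add_nonneg (mul_nonneg (hpos _).le (hpos _).le) (hnn _ _)) (hpos _).le
    rw [aux_decomp ρ A x h3, add_div, mul_div_assoc]
    rw [Real.dist_eq, abs_lt] at *
    constructor <;> linarith [h2.1, h2.2, hA2.1, hA2.2]
  refine ⟨hL, hint, ?_⟩
  have := key.div_const (2 * ∫ y, Real.exp (γ * y) ∂ρ)
  rw [div_self (by positivity)] at this
  refine this.congr fun x => ?_
  rw [div_div, mul_comm (tail ρ x)]
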